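/- For every real number t with 0 < t < 1, it holds that ∑_{k=0}^∞ [(k+3)!/k!]·H_{k+3}²·t^k = [6·ln²(1−t) + 6·Li₂(t)]/(1−t)⁴ + 2(3t² + 4t − 1)/(t²(1−t)⁴) − (11t³ + 18t² − 9t + 2)·ln(1−t)/(t³(1−t)⁴). -/

import Mathlib

/-- The `k`-th harmonic number `H_k = ∑_{j=1}^k 1/j`, with `H_0 = 0`. -/
noncomputable def H (k : ℕ) : ℝ := ∑ j ∈ Finset.range k, (1 : ℝ) / (j + 1)

/-- The dilogarithm `Li₂(t) = ∑_{k=1}^∞ t^k / k²`. -/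
noncomputable def Li2 (t : ℝ) : ℝ := ∑' k : ℕ, t ^ (k + 1) / ((k : ℝ) + 1) ^ 2

lemma H_zero : H 0 = 0 := by simp [H]

lemma H_succ (k : ℕ) : H (k + 1) = H k + 1 / ((k : ℝ) + 1) := by
  simp [H, Finset.sum_range_succ]

/-- Prepending a vanishing zeroth term to a series does not change its sum. -/
lemma hasSum_of_hasSum_succ {f : ℕ → ℝ} {a : ℝ} (h0 : f 0 = 0)
    (h : HasSum (fun k => f (k + 1)) a) : HasSum f a := by
  simpa [h0] using (hasSum_nat_add_iff 1).1 h

/-- Multiplying a power series by the geometric series replaces its coefficients by their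
partial sums. -/
lemma hasSum_partialSums {t D : ℝ} {d c : ℕ → ℝ} (ht : |t| < 1)
    (hd : HasSum (fun k => d k * t ^ k) D) (h0 : c 0 = d 0)
    (hs : ∀ k, c (k + 1) = c k + d (k + 1)) :
    HasSum (fun k => c k * t ^ k) (D / (1 - t)) := by
  have hg : HasSum (fun k : ℕ => t ^ k) (1 - t)⁻¹ :=
    hasSum_geometric_of_norm_lt_one (by simpa using ht)
  have h := hasSum_sum_range_mul_of_summable_norm hd.summable.norm hg.summable.norm
  rw [hd.tsum_eq, hg.tsum_eq, ← div_eq_mul_inv] at h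
  have hc : ∀ n, c n = ∑ i ∈ Finset.range (n + 1), d i := by
    intro n
    induction n with
    | zero => simp [h0]
    | succ n ih => rw [hs, ih, Finset.sum_range_succ _ (n + 1)]
  refine h.congr_fun ?_
  intro n
  rw [hc, Finset.sum_mul]
  refine Finset.sum_congr rfl fun i hi => ?_
  have hi' : i ≤ n := by simpa [Nat.lt_succ_iff] using hi
  rw [mul_assoc, ← pow_add, Nat.add_sub_cancel' hi']

lemma hasSum_log {t : ℝ} (ht : |t| < 1) :
    HasSum (fun k : ℕ => 1 / (k : ℝ) * t ^ k) (-Real.log (1 - t)) := by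
  refine hasSum_of_hasSum_succ (by simp) ?_
  refine (Real.hasSum_pow_div_log_of_abs_lt_one ht).congr_fun fun k => ?_
  push_cast
  ring

lemma sum_inv_mul_inv (n : ℕ) :
    ∑ i ∈ Finset.range (n + 1), 1 / ((i : ℝ) + 1) * (1 / (((n - i : ℕ) : ℝ) + 1))
      = 2 * H (n + 1) / ((n : ℝ) + 2) := by
  have hr : ∑ i ∈ Finset.range (n + 1), 1 / (((n - i : ℕ) : ℝ) + 1) = H (n + 1) := by
    have := Finset.sum_range_reflect (fun i : ℕ => 1 / ((i : ℝ) + 1)) (n + 1)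
    simpa [H] using this
  have : 2 * H (n + 1) / ((n : ℝ) + 2) = ∑ i ∈ Finset.range (n + 1),
      (1 / ((i : ℝ) + 1) + 1 / (((n - i : ℕ) : ℝ) + 1)) / ((n : ℝ) + 2) := by
    rw [← Finset.sum_div, Finset.sum_add_distrib, hr, H, two_mul]
  rw [this]
  refine Finset.sum_congr rfl fun i hi => ?_
  have hi' : i ≤ n := by simpa [Nat.lt_succ_iff] using hi
  obtain ⟨j, rfl⟩ := Nat.exists_eq_add_of_le hi'
  rw [Nat.add_sub_cancel_left]
  push_cast
  have h1 : (i : ℝ) + 1 ≠ 0 := by positivity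
  have h2 : (j : ℝ) + 1 ≠ 0 := by positivity
  have h3 : (i : ℝ) + j + 2 ≠ 0 := by positivity
  field_simp
  ring

lemma hasSum_log_sq {t : ℝ} (ht : |t| < 1) :
    HasSum (fun k : ℕ => 2 * H k / ((k : ℝ) + 1) * t ^ (k + 1)) (Real.log (1 - t) ^ 2) := by
  have hl := Real.hasSum_pow_div_log_of_abs_lt_one ht
  have h := hasSum_sum_range_mul_of_summable_norm hl.summable.norm hl.summable.norm
  rw [hl.tsum_eq, neg_mul_neg, ← sq] at h
  refine hasSum_of_hasSum_succ (by simp [H_zero]) (h.congr_fun fun n => ?_)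
  have e : ((n + 1 : ℕ) : ℝ) + 1 = (n : ℝ) + 2 := by push_cast; ring
  rw [e, ← sum_inv_mul_inv, Finset.sum_mul]
  refine Finset.sum_congr rfl fun i hi => ?_
  have hi' : i ≤ n := by simpa [Nat.lt_succ_iff] using hi
  have e : t ^ (n + 1 + 1) = t ^ (i + 1) * t ^ (n - i + 1) := by
    rw [← pow_add]; congr 1; omega
  rw [e]
  ring

lemma hasSum_Li2 {t : ℝ} (ht : |t| < 1) :
    HasSum (fun k : ℕ => t ^ (k + 1) / ((k : ℝ) + 1) ^ 2) (Li2 t) := by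
  refine Summable.hasSum ?_
  have hl := (Real.hasSum_pow_div_log_of_abs_lt_one ht).summable.norm
  refine Summable.of_norm_bounded hl fun k => ?_
  rw [norm_div, norm_div, norm_pow (_ + _)]
  have h1 : (1 : ℝ) ≤ ‖(k : ℝ) + 1‖ := by
    rw [Real.norm_of_nonneg (by positivity)]
    have : (0 : ℝ) ≤ k := k.cast_nonneg
    linarith
  gcongr
  nlinarith

section GeneratingFunctions

variable {t : ℝ}

lemma hasSum_one (ht : |t| < 1) : HasSum (fun k : ℕ => (1 : ℝ) * t ^ k) (1 / (1 - t)) := by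
  simpa using hasSum_geometric_of_norm_lt_one (ξ := t) (by simpa using ht)

lemma hasSum_succ (ht : |t| < 1) :
    HasSum (fun k : ℕ => ((k : ℝ) + 1) * t ^ k) (1 / (1 - t) / (1 - t)) :=
  hasSum_partialSums ht (hasSum_one ht) (by simp) (by intro k; push_cast; ring)

lemma hasSum_H (ht : |t| < 1) :
    HasSum (fun k : ℕ => H k * t ^ k) (-Real.log (1 - t) / (1 - t)) :=
  hasSum_partialSums ht (hasSum_log ht) (by simp [H_zero])
    (by intro k; rw [H_succ]; push_cast; ring)

lemma hasSum_succ_mul_H (ht : |t| < 1) :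
    HasSum (fun k : ℕ => ((k : ℝ) + 1) * H (k + 1) * t ^ k)
      ((-Real.log (1 - t) / (1 - t) + 1 / (1 - t)) / (1 - t)) := by
  refine hasSum_partialSums (d := fun k => H k + 1) ht ?_ (by simp [H_succ, H_zero]) fun k => ?_
  · simpa only [add_mul] using (hasSum_H ht).add (hasSum_one ht)
  · rw [H_succ (k + 1)]
    have h : (k : ℝ) + 1 + 1 ≠ 0 := by positivity
    push_cast
    field_simp
    ring

lemma hasSum_succ_mul_succ_mul_H (ht : |t| < 1) :
    HasSum (fun k : ℕ => ((k : ℝ) + 1) * (k + 2) * H (k + 2) * t ^ k)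
      ((2 * ((-Real.log (1 - t) / (1 - t) + 1 / (1 - t)) / (1 - t))
        + 1 / (1 - t) / (1 - t)) / (1 - t)) := by
  refine hasSum_partialSums (d := fun k => ((k : ℝ) + 1) * (2 * H (k + 1) + 1)) ht
    ?_ ?_ fun k => ?_
  · refine (((hasSum_succ_mul_H ht).mul_left 2).add (hasSum_succ ht)).congr_fun fun k => ?_
    ring
  · norm_num [H_succ, H_zero]
  · rw [H_succ (k + 2), show k + 1 + 1 = k + 2 from rfl]
    have h : (k : ℝ) + 2 + 1 ≠ 0 := by positivity
    push_cast
    field_simp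
    ring

lemma hasSum_H_sq (ht : |t| < 1) :
    HasSum (fun k : ℕ => H k ^ 2 * t ^ k) ((Real.log (1 - t) ^ 2 + Li2 t) / (1 - t)) := by
  refine hasSum_partialSums (d := fun k => 2 * H k / k - 1 / (k : ℝ) ^ 2) ht
    ?_ (by simp [H_zero]) fun k => ?_
  · refine hasSum_of_hasSum_succ (by simp) ?_
    refine ((hasSum_log_sq ht).add (hasSum_Li2 ht)).congr_fun fun k => ?_
    rw [H_succ]
    have h : (k : ℝ) + 1 ≠ 0 := by positivity
    push_cast
    field_simp
    ring
  · rw [H_succ]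
    have h : (k : ℝ) + 1 ≠ 0 := by positivity
    push_cast
    field_simp
    ring

lemma hasSum_inv_succ (ht0 : t ≠ 0) (ht : |t| < 1) :
    HasSum (fun k : ℕ => 1 / ((k : ℝ) + 1) * t ^ k) (-Real.log (1 - t) / t) := by
  refine ((Real.hasSum_pow_div_log_of_abs_lt_one ht).div_const t).congr_fun fun k => ?_
  field_simp
  ring

lemma hasSum_inv_succ_succ (ht0 : t ≠ 0) (ht : |t| < 1) :
    HasSum (fun k : ℕ => 1 / ((k : ℝ) + 2) * t ^ k) ((-Real.log (1 - t) / t - 1) / t) := by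
  have h := (hasSum_nat_add_iff' 1).2 (hasSum_inv_succ ht0 ht)
  simp only [Finset.range_one, Finset.sum_singleton, Nat.cast_zero, zero_add, pow_zero,
    div_one, mul_one] at h
  refine (h.div_const t).congr_fun fun k => ?_
  have : (k : ℝ) + 2 ≠ 0 := by positivity
  push_cast
  rw [show (k : ℝ) + 1 + 1 = k + 2 by ring]
  field_simp
  ring

lemma hasSum_inv_succ_succ_succ (ht0 : t ≠ 0) (ht : |t| < 1) :
    HasSum (fun k : ℕ => 1 / ((k : ℝ) + 3) * t ^ k)
      (((-Real.log (1 - t) / t - 1) / t - 1 / 2) / t) := by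
  have h := (hasSum_nat_add_iff' 1).2 (hasSum_inv_succ_succ ht0 ht)
  simp only [Finset.range_one, Finset.sum_singleton, Nat.cast_zero, zero_add, pow_zero,
    mul_one] at h
  refine (h.div_const t).congr_fun fun k => ?_
  have : (k : ℝ) + 3 ≠ 0 := by positivity
  push_cast
  rw [show (k : ℝ) + 1 + 2 = k + 3 by ring]
  field_simp
  ring

lemma hasSum_succ_mul_H_sq (ht0 : t ≠ 0) (ht : |t| < 1) :
    HasSum (fun k : ℕ => ((k : ℝ) + 1) * H (k + 1) ^ 2 * t ^ k)
      (((Real.log (1 - t) ^ 2 + Li2 t) / (1 - t) + 2 * (-Real.log (1 - t) / (1 - t))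
        + -Real.log (1 - t) / t) / (1 - t)) := by
  refine hasSum_partialSums (d := fun k => H k ^ 2 + 2 * H k + 1 / ((k : ℝ) + 1)) ht
    ?_ (by simp [H_succ, H_zero]) fun k => ?_
  · refine (((hasSum_H_sq ht).add ((hasSum_H ht).mul_left 2)).add
      (hasSum_inv_succ ht0 ht)).congr_fun fun k => ?_
    ring
  · rw [H_succ (k + 1)]
    have h : (k : ℝ) + 1 + 1 ≠ 0 := by positivity
    push_cast
    field_simp
    ring

lemma hasSum_succ_mul_succ_mul_H_sq (ht0 : t ≠ 0) (ht : |t| < 1) :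
    HasSum (fun k : ℕ => ((k : ℝ) + 1) * (k + 2) * H (k + 2) ^ 2 * t ^ k)
      ((2 * (((Real.log (1 - t) ^ 2 + Li2 t) / (1 - t) + 2 * (-Real.log (1 - t) / (1 - t))
        + -Real.log (1 - t) / t) / (1 - t))
        + 2 * ((-Real.log (1 - t) / (1 - t) + 1 / (1 - t)) / (1 - t))
        + (1 / (1 - t) - (-Real.log (1 - t) / t - 1) / t)) / (1 - t)) := by
  refine hasSum_partialSums (d := fun k => ((k : ℝ) + 1) *
    (2 * H (k + 1) ^ 2 + 2 * H (k + 1) + 1 / ((k : ℝ) + 2))) ht ?_ ?_ fun k => ?_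
  · refine ((((hasSum_succ_mul_H_sq ht0 ht).mul_left 2).add
      ((hasSum_succ_mul_H ht).mul_left 2)).add
      ((hasSum_one ht).sub (hasSum_inv_succ_succ ht0 ht))).congr_fun fun k => ?_
    have h : (k : ℝ) + 2 ≠ 0 := by positivity
    field_simp
    ring
  · norm_num [H_succ, H_zero]
  · rw [H_succ (k + 2), show k + 1 + 1 = k + 2 from rfl]
    have h : (k : ℝ) + 2 + 1 ≠ 0 := by positivity
    have h' : (k : ℝ) + 1 + 2 ≠ 0 := by positivity
    push_cast
    field_simp
    ring

lemma hasSum_succ_mul_succ_mul_succ_mul_H_sq (ht0 : t ≠ 0) (ht : |t| < 1) :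
    HasSum (fun k : ℕ => ((k : ℝ) + 1) * (k + 2) * (k + 3) * H (k + 3) ^ 2 * t ^ k)
      ((3 * ((2 * (((Real.log (1 - t) ^ 2 + Li2 t) / (1 - t) + 2 * (-Real.log (1 - t) / (1 - t))
        + -Real.log (1 - t) / t) / (1 - t))
        + 2 * ((-Real.log (1 - t) / (1 - t) + 1 / (1 - t)) / (1 - t))
        + (1 / (1 - t) - (-Real.log (1 - t) / t - 1) / t)) / (1 - t))
        + 2 * ((2 * ((-Real.log (1 - t) / (1 - t) + 1 / (1 - t)) / (1 - t))
        + 1 / (1 - t) / (1 - t)) / (1 - t))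
        + (1 / (1 - t) / (1 - t) - 1 / (1 - t)
          + 2 * (((-Real.log (1 - t) / t - 1) / t - 1 / 2) / t))) / (1 - t)) := by
  refine hasSum_partialSums (d := fun k => ((k : ℝ) + 1) * (k + 2) *
    (3 * H (k + 2) ^ 2 + 2 * H (k + 2) + 1 / ((k : ℝ) + 3))) ht ?_ ?_ fun k => ?_
  · refine ((((hasSum_succ_mul_succ_mul_H_sq ht0 ht).mul_left 3).add
      ((hasSum_succ_mul_succ_mul_H ht).mul_left 2)).add
      (((hasSum_succ ht).sub (hasSum_one ht)).add
        ((hasSum_inv_succ_succ_succ ht0 ht).mul_left 2))).congr_fun fun k => ?_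
    have h : (k : ℝ) + 3 ≠ 0 := by positivity
    field_simp
    ring
  · norm_num [H_succ, H_zero]
  · rw [H_succ (k + 3), show k + 1 + 2 = k + 3 from rfl]
    have h : (k : ℝ) + 3 + 1 ≠ 0 := by positivity
    have h' : (k : ℝ) + 1 + 3 ≠ 0 := by positivity
    push_cast
    field_simp
    ring

end GeneratingFunctions

theorem stmt_8 (t : ℝ) (ht0 : 0 < t) (ht1 : t < 1) :
    ∑' k : ℕ, ((k + 3).factorial : ℝ) / (k.factorial : ℝ) * H (k + 3) ^ 2 * t ^ k
      = (6 * Real.log (1 - t) ^ 2 + 6 * Li2 t) / (1 - t) ^ 4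
        + 2 * (3 * t ^ 2 + 4 * t - 1) / (t ^ 2 * (1 - t) ^ 4)
        - (11 * t ^ 3 + 18 * t ^ 2 - 9 * t + 2) * Real.log (1 - t) / (t ^ 3 * (1 - t) ^ 4) := by
  have ht : |t| < 1 := by rwa [abs_of_pos ht0]
  have hf : ∀ k : ℕ, ((k + 3).factorial : ℝ) / (k.factorial : ℝ)
      = ((k : ℝ) + 1) * (k + 2) * (k + 3) := by
    intro k
    have : (k.factorial : ℝ) ≠ 0 := by positivity
    rw [div_eq_iff this, Nat.factorial_succ, Nat.factorial_succ, Nat.factorial_succ]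
    push_cast
    ring
  simp only [hf]
  rw [(hasSum_succ_mul_succ_mul_succ_mul_H_sq ht0.ne' ht).tsum_eq]
  have h1 : 1 - t ≠ 0 := by linarith
  have h0 := ht0.ne'
  field_simp
  ring
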